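/- Suppose n ≤ 4. Then for every finite subgroup F of 𝕋^n of any order q ≥ 2 and every h_0 ∈ B with h_0(0) = 1 and ⟨h_0, h_0⟩ = 1 (a normalized continuous low-pass filter), there exist continuous functions h_1, ..., h_{q-1} ∈ B such that the family h_0, h_1, ..., h_{q-1} is orthonormal. -/

import Mathlib

open scoped Real ComplexConjugate
noncomputable section

/-- The `n`-torus `ℝ^n/ℤ^n`. -/
abbrev Torus (n : ℕ) : Type := Fin n → AddCircle (1 : ℝ)

/-- The `A`-valued inner product `⟨f, g⟩(x) = ∑_{w ∈ F} f(x−w) conj(g(x−w))`. -/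
def innerA (n : ℕ) (F : AddSubgroup (Torus n)) [Fintype F]
    (f g : C(Torus n, ℂ)) : Torus n → ℂ :=
  fun x => ∑ w : F, f (x - (w : Torus n)) * conj (g (x - (w : Torus n)))

namespace UnitAddTorus

variable {d : Type*} [Fintype d]

lemma mFourier_apply_add (m : d → ℤ) (x y : UnitAddTorus d) :
    mFourier m (x + y) = mFourier m x * mFourier m y := by
  simp only [mFourier, ContinuousMap.coe_mk, ← Finset.prod_mul_distrib]
  refine Finset.prod_congr rfl fun i _ => ?_
  simp [fourier_apply, smul_add, AddCircle.toCircle_add]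

lemma mFourier_apply_zero (m : d → ℤ) : mFourier m (0 : UnitAddTorus d) = 1 := by
  simp [mFourier]

lemma mFourier_mul_conj (m : d → ℤ) (x : UnitAddTorus d) :
    mFourier m x * conj (mFourier m x) = 1 := by
  rw [← mFourier_neg, ← mFourier_add, add_neg_cancel, mFourier_zero, ContinuousMap.one_apply]

lemma eq_zero_of_forall_mFourier_eq_one {x : UnitAddTorus d} (h : ∀ m, mFourier m x = 1) :
    x = 0 := by
  classical
  funext i
  have hi := h (Pi.single i 1)
  rw [mFourier_single, fourier_one] at hi
  refine AddCircle.injective_toCircle one_ne_zero (Subtype.ext ?_)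
  simpa using hi

/-- The restriction of the characters of a torus to a subgroup. -/
def restrictChar (F : AddSubgroup (UnitAddTorus d)) : (d → ℤ) →+ AddChar F ℂ where
  toFun m :=
    { toFun := fun w => mFourier m w
      map_zero_eq_one' := mFourier_apply_zero m
      map_add_eq_mul' := fun v w => mFourier_apply_add m v w }
  map_zero' := by
    ext w
    simp [mFourier_zero]
  map_add' m k := by
    ext w
    simp [mFourier_add]

lemma restrictChar_apply (F : AddSubgroup (UnitAddTorus d)) (m : d → ℤ) (w : F) :
    restrictChar F m w = mFourier m (w : UnitAddTorus d) := rfl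

lemma restrictChar_surjective (F : AddSubgroup (UnitAddTorus d)) [Finite F] :
    Function.Surjective (restrictChar F) := by
  by_contra hsurj
  simp only [Function.Surjective, not_forall] at hsurj
  obtain ⟨ψ, hψ⟩ := hsurj
  have hne : (ψ : AddChar F ℂ ⧸ (restrictChar F).range) ≠ 0 := by
    rwa [Ne, QuotientAddGroup.eq_zero_iff]
  obtain ⟨ξ, hξ⟩ := AddChar.exists_apply_ne_zero.2 hne
  obtain ⟨a, ha⟩ := AddChar.doubleDualEmb_bijective.surjective
    (ξ.compAddMonoidHom (QuotientAddGroup.mk' (restrictChar F).range))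
  have key (φ : AddChar F ℂ) : φ a = ξ (φ : AddChar F ℂ ⧸ (restrictChar F).range) :=
    DFunLike.congr_fun ha φ
  have ha0 : a = 0 := by
    refine Subtype.ext (eq_zero_of_forall_mFourier_eq_one fun m => ?_)
    rw [← restrictChar_apply, key,
      (QuotientAddGroup.eq_zero_iff _).2 (AddMonoidHom.mem_range.2 ⟨m, rfl⟩),
      AddChar.map_zero_eq_one]
  exact hξ (by rw [← key, ha0, AddChar.map_zero_eq_one])

lemma contDiff_mFourier (m : d → ℤ) {k : WithTop ℕ∞} :
    ContDiff ℝ k fun y : d → ℝ => mFourier m (fun i => (y i : AddCircle (1 : ℝ))) := by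
  simp only [mFourier, ContinuousMap.coe_mk, fourier_coe_apply]
  refine contDiff_prod fun i _ => ContDiff.cexp ?_
  have : ContDiff ℝ k fun y : d → ℝ => ((y i : ℝ) : ℂ) :=
    Complex.ofRealCLM.contDiff.comp (contDiff_apply ℝ ℝ i)
  fun_prop

lemma contDiff_of_mem_span_mFourier {g : C(UnitAddTorus d, ℂ)} {k : WithTop ℕ∞}
    (hg : g ∈ Submodule.span ℂ (Set.range (mFourier (d := d)))) (w : UnitAddTorus d) :
    ContDiff ℝ k fun y : d → ℝ => g ((fun i => (y i : AddCircle (1 : ℝ))) - w) := by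
  choose v hv using fun i => QuotientAddGroup.mk_surjective (w i)
  have hsub (y : d → ℝ) : (fun i => (y i : AddCircle (1 : ℝ))) - w =
      fun i => (((y - v) i : ℝ) : AddCircle (1 : ℝ)) := by
    funext i
    simp only [Pi.sub_apply, AddCircle.coe_sub]
    rw [← hv i]
  simp only [hsub]
  suffices h : ContDiff ℝ k fun y : d → ℝ => g (fun i => (y i : AddCircle (1 : ℝ))) from
    h.comp (contDiff_id.sub contDiff_const)
  induction hg using Submodule.span_induction with
  | mem f hf =>
    obtain ⟨m, rfl⟩ := hf
    exact contDiff_mFourier m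
  | zero => exact contDiff_const
  | add f₁ f₂ _ _ h₁ h₂ => exact h₁.add h₂
  | smul a f _ h => exact contDiff_const.mul h

end UnitAddTorus

section InnerA

variable {n : ℕ} {F : AddSubgroup (Torus n)} [Fintype F]

lemma continuous_innerA (f g : C(Torus n, ℂ)) : Continuous (innerA n F f g) := by
  unfold innerA
  fun_prop

lemma innerA_sub_mem (f g : C(Torus n, ℂ)) (x : Torus n) (w : F) :
    innerA n F f g (x - w) = innerA n F f g x := by
  unfold innerA
  refine Fintype.sum_equiv (Equiv.addLeft w) _ _ fun v => ?_
  simp [sub_sub]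

lemma conj_innerA (f g : C(Torus n, ℂ)) (x : Torus n) :
    conj (innerA n F f g x) = innerA n F g f x := by
  simp [innerA, mul_comm]

lemma innerA_self (f : C(Torus n, ℂ)) (x : Torus n) :
    innerA n F f f x = ((∑ w : F, ‖f (x - w)‖ ^ 2 : ℝ) : ℂ) := by
  simp [innerA, Complex.mul_conj']

lemma innerA_congr_left {f₁ f₂ : C(Torus n, ℂ)} {x : Torus n}
    (h : ∀ w : F, f₁ (x - w) = f₂ (x - w)) (g : C(Torus n, ℂ)) :
    innerA n F f₁ g x = innerA n F f₂ g x := by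
  simp [innerA, h]

lemma innerA_neg_left (f g : C(Torus n, ℂ)) (x : Torus n) :
    innerA n F (-f) g x = -innerA n F f g x := by
  simp [innerA]

lemma innerA_neg_right (f g : C(Torus n, ℂ)) (x : Torus n) :
    innerA n F f (-g) x = -innerA n F f g x := by
  simp [innerA]

lemma innerA_sub_left (f₁ f₂ g : C(Torus n, ℂ)) (x : Torus n) :
    innerA n F (f₁ - f₂) g x = innerA n F f₁ g x - innerA n F f₂ g x := by
  simp [innerA, sub_mul, Finset.sum_sub_distrib]

lemma innerA_sub_right (f g₁ g₂ : C(Torus n, ℂ)) (x : Torus n) :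
    innerA n F f (g₁ - g₂) x = innerA n F f g₁ x - innerA n F f g₂ x := by
  simp [innerA, mul_sub, Finset.sum_sub_distrib]

/-- The inner product is linear over functions that are constant on the coset of `x`. -/
lemma innerA_mul_left {a : C(Torus n, ℂ)} {x : Torus n} (ha : ∀ w : F, a (x - w) = a x)
    (f g : C(Torus n, ℂ)) : innerA n F (a * f) g x = a x * innerA n F f g x := by
  simp [innerA, ha, Finset.mul_sum, mul_assoc]

lemma innerA_mul_right {a : C(Torus n, ℂ)} {x : Torus n} (ha : ∀ w : F, a (x - w) = a x)
    (f g : C(Torus n, ℂ)) : innerA n F f (a * g) x = conj (a x) * innerA n F f g x := by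
  simp [innerA, ha, Finset.mul_sum, mul_left_comm]

lemma innerA_sum_smul_left {ι : Type*} (s : Finset ι) (c : ι → ℂ) (e : ι → C(Torus n, ℂ))
    (g : C(Torus n, ℂ)) (x : Torus n) :
    innerA n F (∑ i ∈ s, c i • e i) g x = ∑ i ∈ s, c i * innerA n F (e i) g x := by
  simp only [innerA, ContinuousMap.coe_sum, Finset.sum_apply, ContinuousMap.smul_apply,
    smul_eq_mul, Finset.sum_mul, Finset.mul_sum, mul_assoc]
  exact Finset.sum_comm

lemma eq_of_innerA_eq_one {u v : C(Torus n, ℂ)} {x : Torus n} (hu : innerA n F u u x = 1)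
    (hv : innerA n F v v x = 1) (huv : innerA n F u v x = 1) (w : F) :
    u (x - w) = v (x - w) := by
  have hvu : innerA n F v u x = 1 := by rw [← conj_innerA, huv, map_one]
  have h : innerA n F (u - v) (u - v) x = 0 := by
    rw [innerA_sub_left, innerA_sub_right, innerA_sub_right, hu, hv, huv, hvu]
    ring
  rw [innerA_self, Complex.ofReal_eq_zero,
    Finset.sum_eq_zero_iff_of_nonneg fun _ _ => by positivity] at h
  simpa [sub_eq_zero] using h w (Finset.mem_univ w)

variable (F) in
/-- The function `u` is a member of an orthonormal family indexed by `ι`, at the index `i₀`. -/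
def HasOrthonormalCompletion {ι : Type*} [DecidableEq ι] (i₀ : ι) (u : C(Torus n, ℂ)) : Prop :=
  ∃ h : ι → C(Torus n, ℂ), h i₀ = u ∧
    ∀ j k x, innerA n F (h j) (h k) x = if j = k then 1 else 0

namespace HasOrthonormalCompletion

variable {ι : Type*} [DecidableEq ι] {i₀ : ι} {u v : C(Torus n, ℂ)}

lemma innerA_self_eq_one (hu : HasOrthonormalCompletion F i₀ u) (x : Torus n) :
    innerA n F u u x = 1 := by
  obtain ⟨h, rfl, hh⟩ := hu
  simp [hh]

lemma neg (hu : HasOrthonormalCompletion F i₀ u) : HasOrthonormalCompletion F i₀ (-u) := by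
  obtain ⟨h, rfl, hh⟩ := hu
  exact ⟨fun j => -h j, rfl, fun j k x => by
    rw [innerA_neg_left, innerA_neg_right, neg_neg, hh]⟩

/-- A complex Householder transformation carries an orthonormal completion of `u` to one of `v`
whenever `⟨u, v⟩` never takes the value `1`. -/
lemma of_innerA_ne_one (hu : HasOrthonormalCompletion F i₀ u)
    (hv : ∀ x, innerA n F v v x = 1) (huv : ∀ x, innerA n F u v x ≠ 1) :
    HasOrthonormalCompletion F i₀ v := by
  have huu := hu.innerA_self_eq_one
  obtain ⟨h, rfl, hh⟩ := hu
  have hD (x : Torus n) : innerA n F (h i₀) (h i₀ - v) x = 1 - innerA n F (h i₀) v x := by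
    rw [innerA_sub_right, huu]
  have hD0 (x : Torus n) : innerA n F (h i₀) (h i₀ - v) x ≠ 0 := by
    rw [hD]
    exact sub_ne_zero.2 (huv x).symm
  have hww (x : Torus n) : innerA n F (h i₀ - v) (h i₀ - v) x =
      innerA n F (h i₀) (h i₀ - v) x + conj (innerA n F (h i₀) (h i₀ - v) x) := by
    rw [innerA_sub_left, hD, innerA_sub_right, hv, map_sub, map_one, conj_innerA]
    ring
  set w := h i₀ - v with hw
  let a (j : ι) : C(Torus n, ℂ) :=
    ⟨fun x => innerA n F (h j) w x / innerA n F (h i₀) w x,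
      (continuous_innerA _ _).div (continuous_innerA _ _) hD0⟩
  have ha (j : ι) (x : Torus n) :
      a j x = innerA n F (h j) w x / innerA n F (h i₀) w x := rfl
  have hinv (j : ι) (x : Torus n) (z : F) : a j (x - z) = a j x := by
    simp only [ha, innerA_sub_mem]
  refine ⟨fun j => h j - a j * w, ?_, fun j k x => ?_⟩
  · ext x
    rw [ContinuousMap.sub_apply, ContinuousMap.mul_apply, ha, div_self (hD0 x), one_mul, hw,
      ContinuousMap.sub_apply, sub_sub_cancel]
  · have hc : conj (innerA n F (h i₀) w x) ≠ 0 := (map_ne_zero _).2 (hD0 x)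
    have hD0x := hD0 x
    rw [innerA_sub_left, innerA_sub_right, innerA_sub_right, innerA_mul_left (hinv j x),
      innerA_mul_left (hinv j x), innerA_mul_right (hinv k x), innerA_mul_right (hinv k x), hh,
      hww, ha, ha, map_div₀, ← conj_innerA (h k) w]
    field_simp
    ring

end HasOrthonormalCompletion

lemma exists_orthonormal_mFourier {q : ℕ} (hq : Fintype.card F = q) :
    ∃ e : Fin q → C(Torus n, ℂ),
      (∀ j, e j ∈ Submodule.span ℂ (Set.range (UnitAddTorus.mFourier (d := Fin n)))) ∧
      ∀ j k x, innerA n F (e j) (e k) x = if j = k then 1 else 0 := by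
  have hcard : Fintype.card (AddChar F ℂ) = q := by rw [AddChar.card_eq, hq]
  let E : Fin q ≃ AddChar F ℂ := (Fintype.equivFinOfCardEq hcard).symm
  choose m hm using fun j => UnitAddTorus.restrictChar_surjective F (E j)
  have hq0 : (q : ℝ) ≠ 0 := by
    rw [← hq]
    exact Nat.cast_ne_zero.2 Fintype.card_ne_zero
  let s : ℂ := ((√q)⁻¹ : ℝ)
  have hs : s * conj s * q = 1 := by
    simp only [s, Complex.conj_ofReal]
    norm_cast
    rw [← mul_inv, Real.mul_self_sqrt (Nat.cast_nonneg q), inv_mul_cancel₀ hq0]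
  refine ⟨fun j => s • UnitAddTorus.mFourier (m j),
    fun j => Submodule.smul_mem _ _ (Submodule.subset_span ⟨_, rfl⟩), fun j k x => ?_⟩
  have hterm (w : F) : (s • UnitAddTorus.mFourier (m j)) (x - (w : Torus n)) *
      conj ((s • UnitAddTorus.mFourier (m k)) (x - (w : Torus n))) =
      s * conj s * UnitAddTorus.mFourier (m j - m k) x *
        UnitAddTorus.restrictChar F (m j - m k) (-w) := by
    rw [UnitAddTorus.restrictChar_apply, mul_assoc, ← UnitAddTorus.mFourier_apply_add,
      AddSubgroup.coe_neg, ← sub_eq_add_neg, sub_eq_add_neg (m j), UnitAddTorus.mFourier_add,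
      UnitAddTorus.mFourier_neg]
    simp only [ContinuousMap.smul_apply, smul_eq_mul, map_mul]
    ring
  have hsum : ∑ w : F, UnitAddTorus.restrictChar F (m j - m k) (-w) =
      if j = k then (q : ℂ) else 0 := by
    classical
    refine (Equiv.sum_comp (Equiv.neg F) (UnitAddTorus.restrictChar F (m j - m k))).trans ?_
    rw [AddChar.sum_eq_ite, map_sub, hm, hm, hq]
    simp [sub_eq_zero]
  rw [innerA, Finset.sum_congr rfl fun w _ => hterm w, ← Finset.mul_sum, hsum]
  split_ifs with hjk
  · subst hjk
    rw [sub_self, UnitAddTorus.mFourier_zero, ContinuousMap.one_apply, mul_one, hs]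
  · rw [mul_zero]

/-- A continuous function is approximated by a trigonometric polynomial which is nowhere a
nonpositive multiple of it on a whole coset of `F`. -/
lemma exists_mem_span_mFourier_ne_neg_smul {u : C(Torus n, ℂ)}
    (hu : ∀ x, innerA n F u u x = 1) :
    ∃ g ∈ Submodule.span ℂ (Set.range (UnitAddTorus.mFourier (d := Fin n))),
      ∀ x, ∀ r : ℝ, 0 ≤ r → ¬ ∀ w : F, g (x - w) = -(r * u (x - w)) := by
  have hcard : 0 < (Fintype.card F : ℝ) := Nat.cast_pos.2 Fintype.card_pos
  have hmem : u ∈ closure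
      (Submodule.span ℂ (Set.range (UnitAddTorus.mFourier (d := Fin n))) : Set C(Torus n, ℂ)) := by
    rw [← Submodule.topologicalClosure_coe, UnitAddTorus.span_mFourier_closure_eq_top]
    trivial
  obtain ⟨g, hg, hug⟩ := Metric.mem_closure_iff.1 hmem (√(Fintype.card F))⁻¹ (by positivity)
  refine ⟨g, hg, fun x r hr hgx => ?_⟩
  have hlt (w : F) : ‖u (x - w)‖ ^ 2 < (Fintype.card F : ℝ)⁻¹ := by
    have h₁ : ‖u (x - w) - g (x - w)‖ < (√(Fintype.card F))⁻¹ := by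
      rw [← dist_eq_norm]
      exact (ContinuousMap.dist_apply_le_dist _).trans_lt hug
    have h₂ : u (x - w) - g (x - w) = ((1 + r : ℝ) : ℂ) * u (x - w) := by
      rw [hgx]
      push_cast
      ring
    rw [h₂, norm_mul, Complex.norm_real, Real.norm_of_nonneg (by positivity)] at h₁
    have h₃ : ‖u (x - w)‖ < (√(Fintype.card F))⁻¹ := by
      nlinarith [norm_nonneg (u (x - w))]
    calc ‖u (x - w)‖ ^ 2 < ((√(Fintype.card F))⁻¹) ^ 2 := by gcongr
      _ = (Fintype.card F : ℝ)⁻¹ := by rw [inv_pow, Real.sq_sqrt hcard.le]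
  have hsum : ∑ w : F, ‖u (x - w)‖ ^ 2 < 1 := by
    calc ∑ w : F, ‖u (x - w)‖ ^ 2 < ∑ _w : F, (Fintype.card F : ℝ)⁻¹ :=
          Finset.sum_lt_sum_of_nonempty Finset.univ_nonempty fun w _ => hlt w
      _ = 1 := by simp [hcard.ne']
  have h1 := hu x
  rw [innerA_self] at h1
  exact hsum.ne (by exact_mod_cast h1)

/-- If `n + 1 < 2 |ι|`, the coefficient vectors of a trigonometric polynomial miss a direction
of the unit sphere of `ι → ℂ`. -/
lemma exists_unit_vector_ne_smul_innerA {ι : Type*} [Fintype ι]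
    (hn : n + 1 < 2 * Fintype.card ι) {e : ι → C(Torus n, ℂ)}
    (he : ∀ j, e j ∈ Submodule.span ℂ (Set.range (UnitAddTorus.mFourier (d := Fin n))))
    {g : C(Torus n, ℂ)}
    (hg : g ∈ Submodule.span ℂ (Set.range (UnitAddTorus.mFourier (d := Fin n)))) :
    ∃ c : ι → ℂ, ∑ j, c j * conj (c j) = 1 ∧
      ∀ x, ∀ t : ℝ, ¬ ∀ j, c j = t * innerA n F g (e j) x := by
  let Ψ : (Fin n → ℝ) × ℝ → (ι → ℂ) := fun y j =>
    (y.2 : ℂ) * innerA n F g (e j) (fun i => (y.1 i : AddCircle (1 : ℝ)))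
  have hΨ : ContDiff ℝ 1 Ψ := by
    refine contDiff_pi.2 fun j => ContDiff.mul (Complex.ofRealCLM.contDiff.comp contDiff_snd) ?_
    refine ContDiff.comp (g := fun y : Fin n → ℝ =>
      innerA n F g (e j) (fun i => (y i : AddCircle (1 : ℝ)))) ?_ contDiff_fst
    unfold innerA
    exact ContDiff.sum fun w _ =>
      (UnitAddTorus.contDiff_of_mem_span_mFourier hg _).mul
        (Complex.conjCLE.contDiff.comp (UnitAddTorus.contDiff_of_mem_span_mFourier (he j) _))
  have hdim : Module.finrank ℝ ((Fin n → ℝ) × ℝ) < Module.finrank ℝ (ι → ℂ) := by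
    rw [Module.finrank_prod, Module.finrank_pi, Module.finrank_self, Module.finrank_pi_fintype]
    simpa [mul_comm] using hn
  obtain ⟨p, hp⟩ := (hΨ.dense_compl_range_of_finrank_lt_finrank hdim).nonempty
  have hp0 : p ≠ 0 := by
    rintro rfl
    exact hp ⟨0, by ext; simp [Ψ]⟩
  have hpos : 0 < ∑ j, ‖p j‖ ^ 2 := by
    obtain ⟨j, hj⟩ := Function.ne_iff.1 hp0
    exact Finset.sum_pos' (fun _ _ => by positivity)
      ⟨j, Finset.mem_univ j, by have := norm_pos_iff.2 hj; positivity⟩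
  set R := √(∑ j, ‖p j‖ ^ 2) with hR
  have hR0 : (R : ℂ) ≠ 0 := Complex.ofReal_ne_zero.2 (Real.sqrt_pos.2 hpos).ne'
  have hR2 : (R : ℂ) * R = ∑ j, p j * conj (p j) := by
    simp only [Complex.mul_conj']
    exact_mod_cast Real.mul_self_sqrt hpos.le
  refine ⟨fun j => p j / R, ?_, fun x t hx => ?_⟩
  · simp only [map_div₀, Complex.conj_ofReal, div_mul_div_comm]
    rw [← Finset.sum_div, ← hR2, div_self (mul_ne_zero hR0 hR0)]
  · choose y hy using fun i => QuotientAddGroup.mk_surjective (x i)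
    refine hp ⟨(y, R * t), funext fun j => ?_⟩
    have hyx : (fun i => (y i : AddCircle (1 : ℝ))) = x := funext hy
    have hj := hx j
    rw [div_eq_iff hR0] at hj
    simp only [Ψ, hyx, hj]
    push_cast
    ring

/-- An orthonormal family of trigonometric polynomials can be moved to start at any normalized
continuous function if it has more than `(n + 1) / 2` members. -/
lemma hasOrthonormalCompletion_of_lt {ι : Type*} [Fintype ι] [DecidableEq ι]
    (hn : n + 1 < 2 * Fintype.card ι) {e : ι → C(Torus n, ℂ)}
    (he : ∀ j, e j ∈ Submodule.span ℂ (Set.range (UnitAddTorus.mFourier (d := Fin n))))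
    (horth : ∀ j k x, innerA n F (e j) (e k) x = if j = k then 1 else 0)
    (i₀ : ι) {u : C(Torus n, ℂ)} (hu : ∀ x, innerA n F u u x = 1) :
    HasOrthonormalCompletion F i₀ u := by
  obtain ⟨g, hg, hgu⟩ := exists_mem_span_mFourier_ne_neg_smul hu
  obtain ⟨c, hc, hcg⟩ := exists_unit_vector_ne_smul_innerA (F := F) hn he hg
  -- the constant combination of the given family in the missed direction
  let P : C(Torus n, ℂ) := ∑ j, c j • e j
  have hPe (j : ι) (x : Torus n) : innerA n F P (e j) x = c j := by
    simp [P, innerA_sum_smul_left, horth]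
  have heP (j : ι) (x : Torus n) : innerA n F (e j) P x = conj (c j) := by
    rw [← conj_innerA, hPe]
  have hPP (x : Torus n) : innerA n F P P x = 1 := by
    rw [← hc]
    change innerA n F (∑ j, c j • e j) P x = _
    simp only [innerA_sum_smul_left, heP]
  have hP : HasOrthonormalCompletion F i₀ P := by
    have hei₀ : HasOrthonormalCompletion F i₀ (e i₀) := ⟨e, rfl, horth⟩
    by_cases h1 : conj (c i₀) = 1
    · refine hei₀.neg.of_innerA_ne_one hPP fun x => ?_
      rw [innerA_neg_left, heP, h1]
      norm_num
    · exact hei₀.of_innerA_ne_one hPP fun x => by rwa [heP]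
  -- the normalization of the approximating polynomial
  let N (x : Torus n) : ℝ := √(∑ w : F, ‖g (x - w)‖ ^ 2)
  have hNinner (x : Torus n) : innerA n F g g x = (N x : ℂ) ^ 2 := by
    rw [innerA_self, ← Complex.ofReal_pow, Real.sq_sqrt (by positivity)]
  have hN0 (x : Torus n) : 0 < N x := by
    refine Real.sqrt_pos.2 (lt_of_le_of_ne (by positivity) fun h => ?_)
    rw [eq_comm, Finset.sum_eq_zero_iff_of_nonneg fun _ _ => by positivity] at h
    refine hgu x 0 le_rfl fun w => ?_
    simpa using h w (Finset.mem_univ w)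
  have hNinv (x : Torus n) (w : F) : N (x - w) = N x := by
    have h := innerA_sub_mem g g x w
    rw [innerA_self, innerA_self, Complex.ofReal_inj] at h
    exact congrArg Real.sqrt h
  have hNcont : Continuous N := by fun_prop
  let a : C(Torus n, ℂ) := ⟨fun x => ((N x)⁻¹ : ℝ), by
    exact Complex.continuous_ofReal.comp (hNcont.inv₀ fun x => (hN0 x).ne')⟩
  have haN (x : Torus n) : a x = ((N x)⁻¹ : ℝ) := rfl
  have hainv (x : Torus n) (w : F) : a (x - w) = a x := by rw [haN, haN, hNinv]
  have hb1 (x : Torus n) : innerA n F (a * g) (a * g) x = 1 := by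
    have : (N x : ℂ) ≠ 0 := Complex.ofReal_ne_zero.2 (hN0 x).ne'
    rw [innerA_mul_left (hainv x), innerA_mul_right (hainv x), hNinner, haN, Complex.conj_ofReal]
    push_cast
    field_simp
  have hb : HasOrthonormalCompletion F i₀ (a * g) := by
    refine hP.of_innerA_ne_one hb1 fun x hx => hcg x (N x)⁻¹ fun j => ?_
    rw [← hPe j x, innerA_congr_left (eq_of_innerA_eq_one (hPP x) (hb1 x) hx),
      innerA_mul_left (hainv x), haN]
  refine hb.neg.of_innerA_ne_one hu fun x hx => hgu x (N x) (hN0 x).le fun w => ?_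
  have h := eq_of_innerA_eq_one (hb.neg.innerA_self_eq_one x) (hu x) hx w
  have hNx : (N x : ℂ) ≠ 0 := Complex.ofReal_ne_zero.2 (hN0 x).ne'
  rw [← h, ContinuousMap.neg_apply, ContinuousMap.mul_apply, hainv, haN]
  push_cast
  field_simp

/-- For a subgroup of order two, a mirror filter completes any normalized function. -/
lemma exists_mirror_filter (hF : Fintype.card F = 2) {u : C(Torus n, ℂ)}
    (hu : ∀ x, innerA n F u u x = 1) :
    ∃ v : C(Torus n, ℂ), (∀ x, innerA n F v v x = 1) ∧ ∀ x, innerA n F u v x = 0 := by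
  classical
  have : Nontrivial F := Fintype.one_lt_card_iff_nontrivial.1 (by omega)
  obtain ⟨w, hw⟩ := exists_ne (0 : F)
  have huniv : (Finset.univ : Finset F) = {0, w} :=
    (Finset.eq_univ_of_card _ (by rw [Finset.card_pair hw.symm, hF])).symm
  have hww : w + w = 0 := by
    have h : w + w ∈ ({0, w} : Finset F) := huniv ▸ Finset.mem_univ _
    simpa [hw] using h
  have hww' : (w : Torus n) + w = 0 := by exact_mod_cast congrArg Subtype.val hww
  have hinner (f g : C(Torus n, ℂ)) (x : Torus n) :
      innerA n F f g x = f x * conj (g x) + f (x - w) * conj (g (x - w)) := by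
    rw [innerA, huniv, Finset.sum_pair hw.symm]
    simp
  obtain ⟨m, hm⟩ : ∃ m, UnitAddTorus.mFourier m (w : Torus n) ≠ 1 := by
    by_contra! h
    exact hw (Subtype.ext (UnitAddTorus.eq_zero_of_forall_mFourier_eq_one h))
  set χ : C(Torus n, ℂ) := UnitAddTorus.mFourier m with hχ
  have hχw : χ w = -1 := by
    have h : χ w * χ w = 1 := by
      rw [hχ, ← UnitAddTorus.mFourier_apply_add, hww', UnitAddTorus.mFourier_apply_zero]
    exact (mul_self_eq_one_iff.1 h).resolve_left hm
  have hχ1 (x : Torus n) : χ x * conj (χ x) = 1 := UnitAddTorus.mFourier_mul_conj m x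
  have hsub (x : Torus n) : x - w - w = x := by rw [sub_sub, hww', sub_zero]
  have hχsub (x : Torus n) : χ (x - w) = -χ x := by
    have h : χ x = χ (x - w) * χ w := by
      rw [hχ, ← UnitAddTorus.mFourier_apply_add, sub_add_cancel]
    rw [h, hχw]
    ring
  refine ⟨χ * ⟨fun x => conj (u (x - w)), by fun_prop⟩, fun x => ?_, fun x => ?_⟩
  · have h := hu x
    rw [hinner] at h ⊢
    simp only [ContinuousMap.mul_apply, ContinuousMap.coe_mk, map_mul, Complex.conj_conj, hsub,
      hχsub, map_neg]
    linear_combination h + (u x * conj (u x) + u (x - w) * conj (u (x - w))) * hχ1 x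
  · rw [hinner]
    simp only [ContinuousMap.mul_apply, ContinuousMap.coe_mk, map_mul, Complex.conj_conj, hsub,
      hχsub, map_neg]
    ring

end InnerA

/-- If `n ≤ 4`, then for every finite subgroup `F` of `𝕋^n` of any order `q ≥ 2` and
every normalized continuous low-pass filter `h_0` (`h_0(0) = 1`, `⟨h_0, h_0⟩ = 1`),
there is a family of continuous functions `h_1, …, h_{q-1}` making
`h_0, h_1, …, h_{q-1}` an orthonormal family. -/
theorem exists_highpass_filters_of_dim_le_four (n : ℕ) (hn : 1 ≤ n) (hn4 : n ≤ 4) :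
    ∀ (q : ℕ) (hq : 2 ≤ q) (F : AddSubgroup (Torus n)) (inst : Fintype F),
      @Fintype.card F inst = q →
      ∀ h0 : C(Torus n, ℂ), h0 0 = 1 →
        @innerA n F inst h0 h0 = (fun _ => 1) →
        ∃ h : Fin q → C(Torus n, ℂ), h ⟨0, by omega⟩ = h0 ∧
          ∀ j k, @innerA n F inst (h j) (h k) = fun _ => if j = k then (1 : ℂ) else 0 := by
  intro q hq F inst hF h0 _ hh0
  have hu (x : Torus n) : innerA n F h0 h0 x = 1 := congrFun hh0 x
  obtain rfl | hq3 : q = 2 ∨ 3 ≤ q := by omega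
  · obtain ⟨v, hv, huv⟩ := exists_mirror_filter hF hu
    have hvu (x : Torus n) : innerA n F v h0 x = 0 := by rw [← conj_innerA, huv, map_zero]
    refine ⟨![h0, v], rfl, fun j k => funext fun x => ?_⟩
    fin_cases j <;> fin_cases k <;> simp [hu, hv, huv, hvu]
  · obtain ⟨e, he, horth⟩ := exists_orthonormal_mFourier hF
    obtain ⟨h, hh, hjk⟩ := hasOrthonormalCompletion_of_lt (by rw [Fintype.card_fin]; omega)
      he horth ⟨0, by omega⟩ hu
    exact ⟨h, hh, fun j k => funext (hjk j k)⟩
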